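/- Let [a,b] be a segment of integers with d = b - a + 1 ≥ 1. The formulas s_i·v = (1 ⊗ s_i)·v, c_i·v = (1 ⊗ c_i)·v, and x_i·v = (a ⊗ ε_i + Σ_{k<i} 1 ⊗ (1 - c_k c_i)s_{ki} - φ ⊗ c_i)·v define an action of the degenerate affine Hecke-Clifford algebra H(d) on Φ_a ⊗ Cl_d, where Φ_a = ℂ⟨φ⟩/(φ² - a) (or ℂ⟨φ⟩/(φ) if a=0), Cl_d is the basic spin representation of the Sergeev algebra, ε_i is the sign involution at position i, and s_{ki} denotes the transposition (k i). -/

import Mathlib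

open CliffordAlgebra

/-- A (degenerate) affine Hecke-Clifford algebra structure on a `ℂ`-algebra `A`. -/
structure AHCA (d : ℕ) (A : Type*) [Ring A] [Algebra ℂ A] where
  c : ℕ → A
  s : ℕ → A
  x : ℕ → A
  c_sq : ∀ i, i < d → c i * c i = -1
  c_anticomm : ∀ i j, i < d → j < d → i ≠ j → c i * c j = -(c j * c i)
  s_sq : ∀ i, i + 1 < d → s i * s i = 1
  braid : ∀ i, i + 2 < d → s i * s (i + 1) * s i = s (i + 1) * s i * s (i + 1)
  s_comm : ∀ i j, i + 1 < d → j + 1 < d → i + 1 < j → s i * s j = s j * s i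
  s_c_left : ∀ i, i + 1 < d → s i * c i = c (i + 1) * s i
  s_c_right : ∀ i, i + 1 < d → s i * c (i + 1) = c i * s i
  s_c_other : ∀ i j, i + 1 < d → j < d → j ≠ i → j ≠ i + 1 → s i * c j = c j * s i
  x_comm : ∀ i j, i < d → j < d → x i * x j = x j * x i
  c_x_same : ∀ i, i < d → c i * x i = -(x i * c i)
  c_x_other : ∀ i j, i < d → j < d → i ≠ j → c i * x j = x j * c i
  s_x_same : ∀ i, i + 1 < d → s i * x i = x (i + 1) * s i - 1 + c i * c (i + 1)
  s_x_other : ∀ i j, i + 1 < d → j < d → j ≠ i → j ≠ i + 1 → s i * x j = x j * s i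

/-- The quadratic form on `ℂ^d` with `Q(e_i) = -1`, whose Clifford algebra is `Cl(d)`. -/
noncomputable def Qd (d : ℕ) : QuadraticForm ℂ (Fin d → ℂ) :=
  QuadraticMap.weightedSumSquares ℂ (fun _ : Fin d => (-1 : ℂ))

/-- The `j`-th Clifford generator `c_j` of `Cl(d)`. -/
noncomputable def cgen (d : ℕ) (j : Fin d) : CliffordAlgebra (Qd d) :=
  CliffordAlgebra.ι (Qd d) (Pi.single j (1 : ℂ))

/-- The underlying space `Φ_a ⊗ Cl_d` of the segment module: the pair `(u₀, u₁)`
represents `1 ⊗ u₀ + φ ⊗ u₁`, where `Cl_d = Cl(d)·𝟏` is the basic spin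
representation (identified with `Cl(d)` itself) and `φ` generates `Φ_a` with
`φ² = a`. -/
noncomputable abbrev SegSpace (d : ℕ) := CliffordAlgebra (Qd d) × CliffordAlgebra (Qd d)

/-- Action of `c_i = 1 ⊗ c_i` on `Φ_a ⊗ Cl_d` (with the Koszul sign on the odd
component `φ ⊗ u₁`). -/
noncomputable def Cop (d : ℕ) (i : ℕ) : Module.End ℂ (SegSpace d) :=
  if h : i < d then
    LinearMap.prodMap (LinearMap.mulLeft ℂ (cgen d ⟨i, h⟩))
      (-(LinearMap.mulLeft ℂ (cgen d ⟨i, h⟩)))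
  else 0

/-- Action of the simple transposition `s_i = 1 ⊗ s_i` on `Φ_a ⊗ Cl_d`, where
`S_d` acts on `Cl_d = Cl(d)·𝟏` through the algebra automorphisms permuting the
Clifford generators. -/
noncomputable def Sop (d : ℕ)
    (perm : Equiv.Perm (Fin d) → (CliffordAlgebra (Qd d) →ₐ[ℂ] CliffordAlgebra (Qd d)))
    (i : ℕ) : Module.End ℂ (SegSpace d) :=
  if h : i + 1 < d then
    LinearMap.prodMap
      (perm (Equiv.swap ⟨i, Nat.lt_of_succ_lt h⟩ ⟨i + 1, h⟩)).toLinearMap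
      (perm (Equiv.swap ⟨i, Nat.lt_of_succ_lt h⟩ ⟨i + 1, h⟩)).toLinearMap
  else 0

/-- The diagonal part `a ε_i + Σ_{k<i} (1 - c_k c_i) s_{ki}` of the action of `x_i`
on each of the two components of `Φ_a ⊗ Cl_d`. -/
noncomputable def Tdiag (d : ℕ) (a : ℤ)
    (perm : Equiv.Perm (Fin d) → (CliffordAlgebra (Qd d) →ₐ[ℂ] CliffordAlgebra (Qd d)))
    (eps : Fin d → (CliffordAlgebra (Qd d) →ₐ[ℂ] CliffordAlgebra (Qd d)))
    (i : ℕ) (h : i < d) : CliffordAlgebra (Qd d) →ₗ[ℂ] CliffordAlgebra (Qd d) :=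
  (a : ℂ) • (eps ⟨i, h⟩).toLinearMap +
    ∑ k : Fin d,
      if (k : ℕ) < i then
        (perm (Equiv.swap k ⟨i, h⟩)).toLinearMap -
          (LinearMap.mulLeft ℂ (cgen d k * cgen d ⟨i, h⟩)) ∘ₗ
            (perm (Equiv.swap k ⟨i, h⟩)).toLinearMap
      else 0

/-- Action of `x_i = a ⊗ ε_i + Σ_{k<i} 1 ⊗ (1 - c_k c_i) s_{ki} - φ ⊗ c_i` on
`Φ_a ⊗ Cl_d` (the last summand mixes the two components, using `φ² = a`). -/
noncomputable def Xop (d : ℕ) (a : ℤ)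
    (perm : Equiv.Perm (Fin d) → (CliffordAlgebra (Qd d) →ₐ[ℂ] CliffordAlgebra (Qd d)))
    (eps : Fin d → (CliffordAlgebra (Qd d) →ₐ[ℂ] CliffordAlgebra (Qd d)))
    (i : ℕ) : Module.End ℂ (SegSpace d) :=
  if h : i < d then
    LinearMap.prodMap (Tdiag d a perm eps i h) (Tdiag d a perm eps i h) +
      LinearMap.prod
        ((a : ℂ) • ((LinearMap.mulLeft ℂ (cgen d ⟨i, h⟩)) ∘ₗ
          LinearMap.snd ℂ (CliffordAlgebra (Qd d)) (CliffordAlgebra (Qd d))))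
        (-((LinearMap.mulLeft ℂ (cgen d ⟨i, h⟩)) ∘ₗ
          LinearMap.fst ℂ (CliffordAlgebra (Qd d)) (CliffordAlgebra (Qd d))))
  else 0

/-- Operators satisfying the relations of the Sergeev algebra together with the
sign involutions at each position, as they occur on the basic spin representation. -/
structure SpinOperators (d : ℕ) (A : Type*) [Ring A] where
  c : Fin d → A
  w : Equiv.Perm (Fin d) → A
  e : Fin d → A
  c_sq : ∀ i, c i * c i = -1
  c_anticomm : ∀ i j, i ≠ j → c i * c j = -(c j * c i)
  w_one : w 1 = 1
  w_mul : ∀ σ τ, w (σ * τ) = w σ * w τ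
  w_c : ∀ σ i, w σ * c i = c (σ i) * w σ
  w_e : ∀ σ i, w σ * e i = e (σ i) * w σ
  e_comm : ∀ i j, e i * e j = e j * e i
  e_c_same : ∀ i, e i * c i = -(c i * e i)
  e_c_other : ∀ i j, i ≠ j → e i * c j = c j * e i
  /-- The relation special to the basic spin representation. -/
  spin : ∀ i j, i ≠ j →
    (e i - e j) * w (Equiv.swap i j) + c i * c j * (e i + e j) * w (Equiv.swap i j) =
      2 * (c i * c j)

namespace SpinOperators

variable {d : ℕ} {A : Type*} [Ring A] (S : SpinOperators d A)

/-- The summand `(1 - c_k c_i) s_{ki}` of a Jucys-Murphy element. -/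
def t (k i : Fin d) : A :=
  S.w (Equiv.swap k i) - S.c k * S.c i * S.w (Equiv.swap k i)

/-- The Jucys-Murphy element `Σ_{k<i} (1 - c_k c_i) s_{ki}` of the Sergeev algebra. -/
def jm (i : Fin d) : A :=
  ∑ k : Fin d, if (k : ℕ) < i then S.t k i else 0

lemma w_mul_t (σ : Equiv.Perm (Fin d)) (k i : Fin d) :
    S.w σ * S.t k i = S.t (σ k) (σ i) * S.w σ := by
  have h : S.w σ * S.w (Equiv.swap k i) = S.w (Equiv.swap (σ k) (σ i)) * S.w σ := by
    rw [← S.w_mul, ← S.w_mul, Equiv.mul_swap_eq_swap_mul]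
  simp only [t, mul_sub, sub_mul]
  congr 1
  rw [← mul_assoc, ← mul_assoc, S.w_c, mul_assoc (S.c (σ k)), S.w_c]
  simp only [mul_assoc, h]

lemma w_mul_jm_of_fix (σ : Equiv.Perm (Fin d)) (j : Fin d) (hj : σ j = j)
    (hlt : ∀ k : Fin d, (σ k : ℕ) < j ↔ (k : ℕ) < j) :
    S.w σ * S.jm j = S.jm j * S.w σ := by
  rw [jm, Finset.mul_sum, Finset.sum_mul,
    ← Equiv.sum_comp σ fun k => (if (k : ℕ) < j then S.t k j else 0) * S.w σ]
  refine Finset.sum_congr rfl fun k _ => ?_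
  by_cases h : (k : ℕ) < j
  · rw [if_pos h, if_pos ((hlt k).2 h), w_mul_t, hj]
  · rw [if_neg h, if_neg (mt (hlt k).1 h), mul_zero, zero_mul]

lemma c_mul_t_right (k i : Fin d) (h : k ≠ i) : S.c i * S.t k i = -(S.t k i * S.c i) := by
  have h1 := S.w_c (Equiv.swap k i) i
  rw [Equiv.swap_apply_right] at h1
  have h2 : S.c i * (S.c k * S.c i) = S.c k := by
    rw [← mul_assoc, S.c_anticomm i k h.symm, neg_mul, mul_assoc, S.c_sq]; simp
  have h3 : S.c k * S.c i * S.c k = S.c i := by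
    rw [S.c_anticomm k i h, neg_mul, mul_assoc, S.c_sq]; simp
  rw [t, mul_sub, sub_mul, h1, mul_assoc _ _ (S.c i), h1,
    ← mul_assoc (S.c i) (S.c k * S.c i), ← mul_assoc (S.c k * S.c i) (S.c k), h2, h3]
  abel

lemma c_mul_t_left (k i : Fin d) : S.c k * S.t k i = S.t k i * S.c k := by
  have h1 := S.w_c (Equiv.swap k i) k
  rw [Equiv.swap_apply_left] at h1
  have h2 : S.c k * (S.c k * S.c i) = -S.c i := by
    rw [← mul_assoc, S.c_sq]; simp
  have h3 : S.c k * S.c i * S.c i = -S.c k := by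
    rw [mul_assoc, S.c_sq]; simp
  rw [t, mul_sub, sub_mul, h1, mul_assoc _ _ (S.c k), h1,
    ← mul_assoc (S.c k) (S.c k * S.c i), ← mul_assoc (S.c k * S.c i) (S.c i), h2, h3]
  simp only [neg_mul, sub_neg_eq_add]
  abel

lemma c_mul_c_mul_c {m k i : Fin d} (hk : m ≠ k) (hi : m ≠ i) :
    S.c m * (S.c k * S.c i) = S.c k * S.c i * S.c m := by
  rw [← mul_assoc, S.c_anticomm m k hk, mul_assoc (S.c k), S.c_anticomm i m hi.symm,
    neg_mul, mul_neg, mul_assoc]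

lemma c_mul_t_other (m k i : Fin d) (hk : m ≠ k) (hi : m ≠ i) :
    S.c m * S.t k i = S.t k i * S.c m := by
  have h1 := S.w_c (Equiv.swap k i) m
  rw [Equiv.swap_apply_of_ne_of_ne hk hi] at h1
  rw [t, mul_sub, sub_mul, h1, mul_assoc _ _ (S.c m), h1,
    ← mul_assoc (S.c m) (S.c k * S.c i), ← mul_assoc (S.c k * S.c i) (S.c m),
    S.c_mul_c_mul_c hk hi]

lemma c_mul_jm_same (i : Fin d) : S.c i * S.jm i = -(S.jm i * S.c i) := by
  rw [jm, Finset.mul_sum, Finset.sum_mul, ← Finset.sum_neg_distrib]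
  refine Finset.sum_congr rfl fun k _ => ?_
  split_ifs with h
  · exact S.c_mul_t_right k i (Fin.ne_of_lt h)
  · simp

lemma c_mul_jm_other (m i : Fin d) (hmi : m ≠ i) : S.c m * S.jm i = S.jm i * S.c m := by
  rw [jm, Finset.mul_sum, Finset.sum_mul]
  refine Finset.sum_congr rfl fun k _ => ?_
  split_ifs with h
  · by_cases hm : m = k
    · subst hm
      exact S.c_mul_t_left m i
    · exact S.c_mul_t_other m k i hm hmi
  · simp

lemma swap_lt_iff {i j k m : Fin d}
    (h : ((i : ℕ) < j ∧ (k : ℕ) < j) ∨ ((j : ℕ) < i ∧ (j : ℕ) < k)) :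
    (Equiv.swap i k m : ℕ) < j ↔ (m : ℕ) < j := by
  rw [Equiv.swap_apply_def]
  split_ifs with h1 h2
  · subst h1; omega
  · subst h2; omega
  · rfl

lemma jm_comm_of_lt {i j : Fin d} (hij : i < j) : S.jm i * S.jm j = S.jm j * S.jm i := by
  rw [jm, Finset.mul_sum, Finset.sum_mul]
  refine Finset.sum_congr rfl fun k _ => ?_
  split_ifs with h
  · have hkj : k < j := lt_trans h hij
    have h1 : S.w (Equiv.swap k i) * S.jm j = S.jm j * S.w (Equiv.swap k i) :=
      S.w_mul_jm_of_fix _ j (Equiv.swap_apply_of_ne_of_ne hkj.ne' hij.ne')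
        fun m => swap_lt_iff (Or.inl ⟨hkj, hij⟩)
    have h2 : Commute (S.c k * S.c i) (S.jm j) :=
      Commute.mul_left (S.c_mul_jm_other k j hkj.ne) (S.c_mul_jm_other i j hij.ne)
    exact Commute.sub_left h1 (h2.mul_left h1)
  · simp

lemma e_mul_t_other (m k i : Fin d) (hk : m ≠ k) (hi : m ≠ i) :
    S.e m * S.t k i = S.t k i * S.e m := by
  have h1 : Commute (S.e m) (S.w (Equiv.swap k i)) := by
    have := S.w_e (Equiv.swap k i) m
    rw [Equiv.swap_apply_of_ne_of_ne hk hi] at this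
    exact this.symm
  have h2 : Commute (S.e m) (S.c k * S.c i) :=
    Commute.mul_right (S.e_c_other m k hk) (S.e_c_other m i hi)
  exact Commute.sub_right h1 (h2.mul_right h1)

lemma e_mul_jm_of_lt {i j : Fin d} (hij : i < j) : S.e j * S.jm i = S.jm i * S.e j := by
  rw [jm, Finset.mul_sum, Finset.sum_mul]
  refine Finset.sum_congr rfl fun k _ => ?_
  split_ifs with h
  · exact S.e_mul_t_other j k i (lt_trans (show k < i from h) hij).ne' hij.ne'
  · simp

lemma e_mul_t_sub {i j : Fin d} (hij : i ≠ j) :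
    S.e i * S.t i j - S.t i j * S.e i = 2 * (S.c i * S.c j) := by
  have h1 := S.w_e (Equiv.swap i j) i
  rw [Equiv.swap_apply_left] at h1
  have h2 : S.e i * (S.c i * S.c j) = -(S.c i * S.c j * S.e i) := by
    rw [← mul_assoc, S.e_c_same, neg_mul, mul_assoc, S.e_c_other i j hij, mul_assoc]
  rw [← S.spin i j hij, t, mul_sub, sub_mul, ← mul_assoc, h2]
  simp only [sub_mul, mul_add, add_mul, neg_mul, mul_assoc, h1]
  abel

lemma e_mul_jm_sub {i j : Fin d} (hij : i < j) :
    S.e i * S.jm j - S.jm j * S.e i = 2 * (S.c i * S.c j) := by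
  rw [jm, Finset.mul_sum, Finset.sum_mul, ← Finset.sum_sub_distrib,
    Finset.sum_eq_single i, if_pos (show (i : ℕ) < j from hij), S.e_mul_t_sub hij.ne]
  · intro k _ hk
    split_ifs with h
    · rw [S.e_mul_t_other i k j hk.symm hij.ne, sub_self]
    · simp
  · simp

section Segment

variable [Algebra ℂ A] (a : ℂ)

/-- The diagonal part `a ε_i + Σ_{k<i} (1 - c_k c_i) s_{ki}` of the action of `x_i`. -/
def diag (i : Fin d) : A := a • S.e i + S.jm i

lemma diag_commutator_of_lt {i j : Fin d} (hij : i < j) :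
    S.diag a i * S.diag a j - S.diag a j * S.diag a i = a • (2 * (S.c i * S.c j)) := by
  rw [← S.e_mul_jm_sub hij]
  simp only [diag, mul_add, add_mul, smul_mul_assoc, mul_smul_comm, smul_add, smul_sub]
  rw [S.e_comm i j, S.jm_comm_of_lt hij, S.e_mul_jm_of_lt hij]
  abel

lemma diag_commutator {i j : Fin d} (hij : i ≠ j) :
    S.diag a i * S.diag a j - S.diag a j * S.diag a i = a • (2 * (S.c i * S.c j)) := by
  rcases lt_or_gt_of_ne hij with h | h
  · exact S.diag_commutator_of_lt a h
  · rw [← neg_sub, S.diag_commutator_of_lt a h, S.c_anticomm i j hij, mul_neg, smul_neg]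

lemma c_mul_diag_same (i : Fin d) : S.c i * S.diag a i = -(S.diag a i * S.c i) := by
  simp only [diag, mul_add, add_mul, smul_mul_assoc, mul_smul_comm, S.e_c_same,
    S.c_mul_jm_same, smul_neg]
  abel

lemma c_mul_diag_other {i j : Fin d} (hij : i ≠ j) :
    S.c i * S.diag a j = S.diag a j * S.c i := by
  simp only [diag, mul_add, add_mul, smul_mul_assoc, mul_smul_comm,
    S.e_c_other j i hij.symm, S.c_mul_jm_other i j hij]

lemma w_mul_diag_adjacent {i j : Fin d} (hij : (j : ℕ) = i + 1) :
    S.w (Equiv.swap i j) * S.diag a i =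
      S.diag a j * S.w (Equiv.swap i j) - 1 + S.c i * S.c j := by
  have hne : i ≠ j := fun h => by subst h; omega
  have hw : S.w (Equiv.swap i j) * S.w (Equiv.swap i j) = 1 := by
    rw [← S.w_mul, Equiv.swap_mul_self, S.w_one]
  have ht : S.t i j * S.w (Equiv.swap i j) = 1 - S.c i * S.c j := by
    rw [t, sub_mul, mul_assoc, hw, mul_one]
  have hjm : S.jm j = S.t i j + ∑ k : Fin d, if (k : ℕ) < i then S.t k j else 0 := by
    rw [jm, ← Fintype.sum_ite_eq i fun k => S.t k j, ← Finset.sum_add_distrib]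
    refine Finset.sum_congr rfl fun k _ => ?_
    rcases lt_trichotomy k i with h | h | h
    · have : (k : ℕ) < i := h
      rw [if_pos (by omega), if_pos this, if_neg h.ne', zero_add]
    · subst h
      simp [hij]
    · have : (i : ℕ) < k := h
      rw [if_neg (show ¬(k : ℕ) < j by omega), if_neg (show ¬(k : ℕ) < i by omega),
        if_neg h.ne, zero_add]
  have hs : S.w (Equiv.swap i j) * S.jm i =
      (∑ k : Fin d, if (k : ℕ) < i then S.t k j else 0) * S.w (Equiv.swap i j) := by
    rw [jm, Finset.mul_sum, Finset.sum_mul]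
    refine Finset.sum_congr rfl fun k _ => ?_
    split_ifs with h
    · rw [S.w_mul_t, Equiv.swap_apply_left, Equiv.swap_apply_of_ne_of_ne]
      · exact Fin.ne_of_lt h
      · exact Fin.ne_of_lt (show (k : ℕ) < j by omega)
    · simp
  simp only [diag, mul_add, add_mul, mul_smul_comm, smul_mul_assoc, S.w_e,
    Equiv.swap_apply_left, hs, hjm, ht]
  abel

lemma w_mul_diag_other {i j k : Fin d} (hij : (j : ℕ) = i + 1) (hki : k ≠ i) (hkj : k ≠ j) :
    S.w (Equiv.swap i j) * S.diag a k = S.diag a k * S.w (Equiv.swap i j) := by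
  have h := Equiv.swap_apply_of_ne_of_ne hki hkj
  have hi : (k : ℕ) ≠ i := fun h => hki (Fin.ext h)
  have hj : (k : ℕ) ≠ j := fun h => hkj (Fin.ext h)
  simp only [diag, mul_add, add_mul, mul_smul_comm, smul_mul_assoc, S.w_e, h]
  rw [S.w_mul_jm_of_fix _ k h fun m => swap_lt_iff (by omega)]

end Segment

end SpinOperators

section Block

variable {M : Type*} [AddCommGroup M] [Module ℂ M]

/-- The endomorphism of `M × M` given by a two-by-two matrix of endomorphisms of `M`. -/
def blockEnd (p q r s : Module.End ℂ M) : Module.End ℂ (M × M) :=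
  LinearMap.prod (LinearMap.coprod p q) (LinearMap.coprod r s)

lemma blockEnd_mul (p q r s p' q' r' s' : Module.End ℂ M) :
    blockEnd p q r s * blockEnd p' q' r' s' =
      blockEnd (p * p' + q * r') (p * q' + q * s') (r * p' + s * r') (r * q' + s * s') := by
  refine LinearMap.ext fun u => Prod.ext ?_ ?_ <;>
    simp [blockEnd] <;> abel

lemma blockEnd_add (p q r s p' q' r' s' : Module.End ℂ M) :
    blockEnd p q r s + blockEnd p' q' r' s' =
      blockEnd (p + p') (q + q') (r + r') (s + s') := by
  refine LinearMap.ext fun u => Prod.ext ?_ ?_ <;>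
    simp [blockEnd] <;> abel

lemma blockEnd_neg (p q r s : Module.End ℂ M) :
    -blockEnd p q r s = blockEnd (-p) (-q) (-r) (-s) := by
  refine LinearMap.ext fun u => Prod.ext ?_ ?_ <;>
    simp [blockEnd] <;> abel

lemma one_eq_blockEnd : (1 : Module.End ℂ (M × M)) = blockEnd 1 0 0 1 := by
  refine LinearMap.ext fun u => Prod.ext ?_ ?_ <;> simp [blockEnd]

/-- Two-by-two block matrices of spin operators satisfy the affine Hecke-Clifford relations. -/
lemma SpinOperators.exists_ahca {d : ℕ} (S : SpinOperators d (Module.End ℂ M)) (a : ℂ)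
    {C W X : ℕ → Module.End ℂ (M × M)}
    (hC : ∀ {i : ℕ} (h : i < d), C i = blockEnd (S.c ⟨i, h⟩) 0 0 (-S.c ⟨i, h⟩))
    (hS : ∀ {i : ℕ} (h : i + 1 < d), W i =
      blockEnd (S.w (Equiv.swap ⟨i, Nat.lt_of_succ_lt h⟩ ⟨i + 1, h⟩)) 0 0
        (S.w (Equiv.swap ⟨i, Nat.lt_of_succ_lt h⟩ ⟨i + 1, h⟩)))
    (hX : ∀ {i : ℕ} (h : i < d), X i =
      blockEnd (S.diag a ⟨i, h⟩) (a • S.c ⟨i, h⟩) (-S.c ⟨i, h⟩) (S.diag a ⟨i, h⟩)) :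
    ∃ H : AHCA d (Module.End ℂ (M × M)), H.c = C ∧ H.s = W ∧ H.x = X := by
  have hne : ∀ {i j : ℕ} (hi : i < d) (hj : j < d), i ≠ j → (⟨i, hi⟩ : Fin d) ≠ ⟨j, hj⟩ :=
    fun _ _ h h' => h (Fin.mk.inj_iff.1 h')
  refine ⟨⟨C, W, X, ?_, ?_, ?_, ?_, ?_, ?_, ?_, ?_, ?_, ?_, ?_,
    ?_, ?_⟩, rfl, rfl, rfl⟩
  · intro i hi
    simp [hC hi, blockEnd_mul, one_eq_blockEnd, blockEnd_neg, S.c_sq]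
  · intro i j hi hj hij
    simp [hC hi, hC hj, blockEnd_mul, blockEnd_neg, S.c_anticomm _ _ (hne hi hj hij)]
  · intro i hi
    simp [hS hi, blockEnd_mul, one_eq_blockEnd, ← S.w_mul, S.w_one]
  · intro i hi
    have h : ∀ p q r : Fin d, p ≠ q → q ≠ r → p ≠ r →
        Equiv.swap p q * Equiv.swap q r * Equiv.swap p q =
          Equiv.swap q r * Equiv.swap p q * Equiv.swap q r := by
      intro p q r hpq hqr hpr
      rw [Equiv.swap_mul_swap_mul_swap hpq hpr, Equiv.swap_comm r p,
        ← Equiv.swap_mul_swap_mul_swap hqr.symm hpr.symm, Equiv.swap_comm q p,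
        Equiv.swap_comm r q]
    have hi' : i + 1 < d := by omega
    simp only [hS hi, hS hi', blockEnd_mul, ← S.w_mul, mul_zero, zero_mul, add_zero, zero_add]
    rw [h] <;> exact hne _ _ (by omega)
  · intro i j hi hj hij
    have h : ∀ p q r t : Fin d, p ≠ r → p ≠ t → q ≠ r → q ≠ t →
        Equiv.swap p q * Equiv.swap r t = Equiv.swap r t * Equiv.swap p q := by
      intro p q r t h1 h2 h3 h4
      rw [Equiv.mul_swap_eq_swap_mul, Equiv.swap_apply_of_ne_of_ne h1.symm h3.symm,
        Equiv.swap_apply_of_ne_of_ne h2.symm h4.symm]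
    simp only [hS hi, hS hj, blockEnd_mul, ← S.w_mul, mul_zero, zero_mul, add_zero, zero_add]
    rw [h] <;> exact hne _ _ (by omega)
  · intro i hi
    have hi' : i < d := by omega
    simp [hS hi, hC hi, hC hi', blockEnd_mul, S.w_c]
  · intro i hi
    have hi' : i < d := by omega
    simp [hS hi, hC hi, hC hi', blockEnd_mul, S.w_c]
  · intro i j hi hj h1 h2
    simp [hS hi, hC hj, blockEnd_mul, S.w_c,
      Equiv.swap_apply_of_ne_of_ne (hne hj (Nat.lt_of_succ_lt hi) h1) (hne hj hi h2)]
  · intro i j hi hj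
    by_cases hij : i = j
    · subst hij
      rfl
    have h := hne hi hj hij
    have hc := S.c_anticomm _ _ h
    have hd : S.diag a ⟨i, hi⟩ * S.diag a ⟨j, hj⟩ = S.diag a ⟨j, hj⟩ * S.diag a ⟨i, hi⟩ +
        a • (2 * (S.c ⟨i, hi⟩ * S.c ⟨j, hj⟩)) :=
      eq_add_of_sub_eq' (S.diag_commutator a h)
    simp only [hX hi, hX hj, blockEnd_mul]
    congr 1 <;>
      simp only [hd, hc, ← S.c_mul_diag_other a h, ← S.c_mul_diag_other a h.symm, two_mul,
        smul_mul_assoc, mul_smul_comm, neg_mul, mul_neg, smul_add, smul_neg] <;>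
      abel
  · intro i hi
    simp [hC hi, hX hi, blockEnd_mul, blockEnd_neg, S.c_mul_diag_same]
  · intro i j hi hj hij
    have h := hne hi hj hij
    simp [hC hi, hX hj, blockEnd_mul, S.c_mul_diag_other a h, S.c_anticomm _ _ h]
  · intro i hi
    have hi' : i < d := by omega
    simp [hS hi, hX hi, hX hi', hC hi, hC hi', blockEnd_mul, one_eq_blockEnd, blockEnd_neg,
      blockEnd_add, sub_eq_add_neg, S.w_c, S.w_mul_diag_adjacent a
        (show ((⟨i + 1, hi⟩ : Fin d) : ℕ) = (⟨i, hi'⟩ : Fin d) + 1 from rfl)]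
  · intro i j hi hj h1 h2
    have hji := hne hj (Nat.lt_of_succ_lt hi) h1
    have hji' := hne hj hi h2
    simp [hS hi, hX hj, blockEnd_mul, S.w_c, Equiv.swap_apply_of_ne_of_ne hji hji',
      S.w_mul_diag_other a
        (show ((⟨i + 1, hi⟩ : Fin d) : ℕ) = (⟨i, Nat.lt_of_succ_lt hi⟩ : Fin d) + 1 from rfl)
        hji hji']

end Block

section Clifford

variable {d : ℕ}

lemma cgen_mul_self (i : Fin d) : cgen d i * cgen d i = -1 := by
  have h : Qd d (Pi.single i 1) = -1 := by
    rw [Qd, QuadraticMap.weightedSumSquares_apply, Finset.sum_eq_single i]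
    · simp
    · intro k _ hk
      simp [hk]
    · simp
  rw [cgen, CliffordAlgebra.ι_sq_scalar, h, map_neg, map_one]

lemma cgen_mul_cgen {i j : Fin d} (hij : i ≠ j) :
    cgen d i * cgen d j = -(cgen d j * cgen d i) := by
  refine eq_neg_of_add_eq_zero_left ?_
  have h : QuadraticMap.polar (Qd d) (Pi.single i 1) (Pi.single j 1) = 0 := by
    simp only [QuadraticMap.polar, Qd, QuadraticMap.weightedSumSquares_apply,
      ← Finset.sum_sub_distrib]
    refine Finset.sum_eq_zero fun k _ => ?_
    by_cases hi : k = i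
    · subst hi
      simp [hij]
    · simp [hi]
  rw [cgen, cgen, CliffordAlgebra.ι_mul_ι_add_swap, h, map_zero]

lemma ι_eq_sum_cgen (v : Fin d → ℂ) : ι (Qd d) v = ∑ i, v i • cgen d i := by
  conv_lhs => rw [pi_eq_sum_univ' v]
  simp [cgen]

lemma clifford_algHom_ext {B : Type*} [Ring B] [Algebra ℂ B]
    {f g : CliffordAlgebra (Qd d) →ₐ[ℂ] B} (h : ∀ i, f (cgen d i) = g (cgen d i)) : f = g := by
  refine CliffordAlgebra.hom_ext (LinearMap.ext fun v => ?_)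
  simp [ι_eq_sum_cgen, h]

/-- Linear maps on the Clifford algebra are equal if they agree at `1` and commute
with left multiplication by each generator up to the same scalar. -/
lemma clifford_linearMap_ext {F G : Module.End ℂ (CliffordAlgebra (Qd d))} (z : Fin d → ℂ)
    (h1 : F 1 = G 1)
    (hF : ∀ i u, F (cgen d i * u) = z i • (cgen d i * F u))
    (hG : ∀ i u, G (cgen d i * u) = z i • (cgen d i * G u)) : F = G := by
  refine LinearMap.ext fun u => ?_
  induction u using CliffordAlgebra.left_induction with
  | algebraMap r => rw [Algebra.algebraMap_eq_smul_one, map_smul, map_smul, h1]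
  | add x y hx hy => rw [map_add, map_add, hx, hy]
  | ι_mul x m hx =>
    simp only [ι_eq_sum_cgen, Finset.sum_mul, map_sum, smul_mul_assoc, map_smul, hF, hG, hx]

lemma cgen_mul_cgen_mul_self (i : Fin d) (u : CliffordAlgebra (Qd d)) :
    cgen d i * (cgen d i * u) = -u := by
  rw [← mul_assoc, cgen_mul_self, neg_one_mul]

lemma cgen_mul_cgen_mul {i j : Fin d} (hij : i ≠ j) (u : CliffordAlgebra (Qd d)) :
    cgen d i * (cgen d j * u) = -(cgen d j * (cgen d i * u)) := by
  rw [← mul_assoc, cgen_mul_cgen hij, neg_mul, mul_assoc]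

/-- The operators of the basic spin representation, realised on the Clifford algebra. -/
noncomputable def cliffordSpinOperators
    (perm : Equiv.Perm (Fin d) → (CliffordAlgebra (Qd d) →ₐ[ℂ] CliffordAlgebra (Qd d)))
    (hperm : ∀ (σ : Equiv.Perm (Fin d)) (j : Fin d), perm σ (cgen d j) = cgen d (σ j))
    (eps : Fin d → (CliffordAlgebra (Qd d) →ₐ[ℂ] CliffordAlgebra (Qd d)))
    (heps : ∀ i j : Fin d, eps i (cgen d j) = (if j = i then (-1 : ℂ) else 1) • cgen d j) :
    SpinOperators d (Module.End ℂ (CliffordAlgebra (Qd d))) where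
  c i := LinearMap.mulLeft ℂ (cgen d i)
  w σ := (perm σ).toLinearMap
  e i := (eps i).toLinearMap
  c_sq i := LinearMap.ext fun u => by
    simp [cgen_mul_cgen_mul_self]
  c_anticomm i j hij := LinearMap.ext fun u => by
    simp [cgen_mul_cgen_mul hij]
  w_one := congrArg AlgHom.toLinearMap
    (show perm 1 = AlgHom.id ℂ _ from clifford_algHom_ext fun i => by simp [hperm])
  w_mul σ τ := congrArg AlgHom.toLinearMap
    (show perm (σ * τ) = (perm σ).comp (perm τ) from
      clifford_algHom_ext fun i => by simp [hperm])
  w_c σ i := LinearMap.ext fun u => by simp [hperm]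
  w_e σ i := congrArg AlgHom.toLinearMap
    (show (perm σ).comp (eps i) = (eps (σ i)).comp (perm σ) from
      clifford_algHom_ext fun k => by by_cases h : k = i <;> simp [hperm, heps, h])
  e_comm i j := congrArg AlgHom.toLinearMap
    (show (eps i).comp (eps j) = (eps j).comp (eps i) from
      clifford_algHom_ext fun k => by
        simp only [AlgHom.comp_apply, heps, map_smul]
        exact smul_comm _ _ _)
  e_c_same i := LinearMap.ext fun u => by simp [heps]
  e_c_other i j hij := LinearMap.ext fun u => by simp [heps, hij.symm]
  spin i j hij := by
    refine clifford_linearMap_ext (fun m => if m = i ∨ m = j then -1 else 1) ?_ ?_ ?_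
    · simp [two_mul, mul_add]
    · intro m u
      by_cases hi : m = i
      · subst hi
        simp [hperm, heps, hij.symm, mul_add, mul_sub, cgen_mul_cgen_mul_self]
        abel
      · by_cases hj : m = j
        · subst hj
          simp [hperm, heps, hij, mul_add, mul_sub, cgen_mul_cgen_mul_self,
            cgen_mul_cgen_mul hij.symm]
          abel
        · simp [hperm, heps, hi, hj, Equiv.swap_apply_of_ne_of_ne, mul_add, mul_sub,
            cgen_mul_cgen_mul hi, cgen_mul_cgen_mul hj]
    · intro m u
      by_cases hi : m = i
      · subst hi
        simp [two_mul, mul_add, cgen_mul_cgen_mul_self, cgen_mul_cgen_mul hij.symm]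
      · by_cases hj : m = j
        · subst hj
          simp [two_mul, mul_add, cgen_mul_cgen_mul_self, cgen_mul_cgen_mul hij.symm]
        · simp [two_mul, hi, hj, mul_add, cgen_mul_cgen_mul hi, cgen_mul_cgen_mul hj]

lemma Cop_eq_blockEnd {i : ℕ} (h : i < d) :
    Cop d i = blockEnd (LinearMap.mulLeft ℂ (cgen d ⟨i, h⟩)) 0 0
      (-LinearMap.mulLeft ℂ (cgen d ⟨i, h⟩)) := by
  rw [Cop, dif_pos h]
  refine LinearMap.ext fun u => Prod.ext ?_ ?_ <;> simp [blockEnd]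

lemma Sop_eq_blockEnd
    (perm : Equiv.Perm (Fin d) → (CliffordAlgebra (Qd d) →ₐ[ℂ] CliffordAlgebra (Qd d)))
    {i : ℕ} (h : i + 1 < d) :
    Sop d perm i =
      blockEnd (perm (Equiv.swap ⟨i, Nat.lt_of_succ_lt h⟩ ⟨i + 1, h⟩)).toLinearMap 0 0
        (perm (Equiv.swap ⟨i, Nat.lt_of_succ_lt h⟩ ⟨i + 1, h⟩)).toLinearMap := by
  rw [Sop, dif_pos h]
  refine LinearMap.ext fun u => Prod.ext ?_ ?_ <;> simp [blockEnd]

lemma Tdiag_eq_diag (a : ℤ)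
    (perm : Equiv.Perm (Fin d) → (CliffordAlgebra (Qd d) →ₐ[ℂ] CliffordAlgebra (Qd d)))
    (hperm : ∀ (σ : Equiv.Perm (Fin d)) (j : Fin d), perm σ (cgen d j) = cgen d (σ j))
    (eps : Fin d → (CliffordAlgebra (Qd d) →ₐ[ℂ] CliffordAlgebra (Qd d)))
    (heps : ∀ i j : Fin d, eps i (cgen d j) = (if j = i then (-1 : ℂ) else 1) • cgen d j)
    {i : ℕ} (h : i < d) :
    Tdiag d a perm eps i h = (cliffordSpinOperators perm hperm eps heps).diag a ⟨i, h⟩ := by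
  simp only [Tdiag, SpinOperators.diag, SpinOperators.jm, SpinOperators.t,
    LinearMap.mulLeft_mul]
  rfl

lemma Xop_eq_blockEnd (a : ℤ)
    (perm : Equiv.Perm (Fin d) → (CliffordAlgebra (Qd d) →ₐ[ℂ] CliffordAlgebra (Qd d)))
    (eps : Fin d → (CliffordAlgebra (Qd d) →ₐ[ℂ] CliffordAlgebra (Qd d)))
    {i : ℕ} (h : i < d) :
    Xop d a perm eps i =
      blockEnd (Tdiag d a perm eps i h) ((a : ℂ) • LinearMap.mulLeft ℂ (cgen d ⟨i, h⟩))
        (-LinearMap.mulLeft ℂ (cgen d ⟨i, h⟩)) (Tdiag d a perm eps i h) := by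
  rw [Xop, dif_pos h]
  refine LinearMap.ext fun u => Prod.ext ?_ ?_ <;> simp [blockEnd, add_comm]

end Clifford

/-- For a segment `[a, b]` with `d = b - a + 1 ≥ 1`, the formulas
`s_i·v = (1 ⊗ s_i)·v`, `c_i·v = (1 ⊗ c_i)·v` and
`x_i·v = (a ⊗ ε_i + Σ_{k<i} 1 ⊗ (1 - c_k c_i)s_{ki} - φ ⊗ c_i)·v`
define an action of the degenerate affine Hecke-Clifford algebra
`H_{Cl}^{aff}(d)` on `Φ_a ⊗ Cl_d`. -/
theorem segment_representation (d : ℕ) (hd : 1 ≤ d) (a b : ℤ) (hab : b - a + 1 = d)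
    (perm : Equiv.Perm (Fin d) → (CliffordAlgebra (Qd d) →ₐ[ℂ] CliffordAlgebra (Qd d)))
    (hperm : ∀ (σ : Equiv.Perm (Fin d)) (j : Fin d), perm σ (cgen d j) = cgen d (σ j))
    (eps : Fin d → (CliffordAlgebra (Qd d) →ₐ[ℂ] CliffordAlgebra (Qd d)))
    (heps : ∀ i j : Fin d, eps i (cgen d j) = (if j = i then (-1 : ℂ) else 1) • cgen d j) :
    ∃ H : AHCA d (Module.End ℂ (SegSpace d)),
      H.c = Cop d ∧ H.s = Sop d perm ∧ H.x = Xop d a perm eps := by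
  exact (cliffordSpinOperators perm hperm eps heps).exists_ahca a Cop_eq_blockEnd
    (Sop_eq_blockEnd perm) fun h => by
      rw [Xop_eq_blockEnd a perm eps h, Tdiag_eq_diag a perm hperm eps heps]
      rfl
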